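/- Let Ω ⊆ ℂⁿ be open and Φ continuous on Ω. Let A = (A_ħ) be a family of linear operators on L²_loc(Ω) that is uniformly continuous from L²_{Φ,loc}(Ω) to L²_{Φ,loc}(Ω) (for every open Ω̃₂ ⋐ Ω there exist open Ω̃₁ ⋐ Ω and C > 0, independent of ħ, with ‖A_ħ u‖_{L²_Φ(Ω̃₂)} ≤ C ‖u‖_{L²_Φ(Ω̃₁)} for all u and all small ħ). Let Φ₁ be continuous on Ω with Φ₁(z) < Φ(z) for all z ∈ Ω. Then there exists a continuous Φ₂ on Ω with Φ₂ < Φ pointwise such that A is uniformly continuous from L²_{Φ₁,loc}(Ω) to L²_{Φ₂,loc}(Ω). -/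

import Mathlib

open MeasureTheory Complex Matrix Set Metric
open scoped ENNReal NNReal Topology

noncomputable section

abbrev Cn (n : ℕ) := Fin n → ℂ

def wDz {n : ℕ} (j : Fin n) (f : Cn n → ℂ) (z : Cn n) : ℂ :=
  (1 / 2 : ℂ) * (fderiv ℝ f z (Pi.single j 1) - Complex.I * fderiv ℝ f z (Pi.single j Complex.I))

def wDzbar {n : ℕ} (j : Fin n) (f : Cn n → ℂ) (z : Cn n) : ℂ :=
  (1 / 2 : ℂ) * (fderiv ℝ f z (Pi.single j 1) + Complex.I * fderiv ℝ f z (Pi.single j Complex.I))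

def cplx {n : ℕ} (Φ : Cn n → ℝ) : Cn n → ℂ := fun z => (Φ z : ℂ)

def levi {n : ℕ} (Φ : Cn n → ℝ) (z : Cn n) : Matrix (Fin n) (Fin n) ℂ :=
  Matrix.of fun j k => wDz j (wDzbar k (cplx Φ)) z

def conjv {n : ℕ} (z : Cn n) : Cn n := fun j => starRingEnd ℂ (z j)

def dotC {n : ℕ} (a b : Cn n) : ℂ := ∑ j, a j * b j

def wGrad {n : ℕ} (Φ : Cn n → ℝ) (x : Cn n) : Cn n := fun j => wDz j (cplx Φ) x

def L2wNorm {n : ℕ} (hb : ℝ) (Φ : Cn n → ℝ) (U : Set (Cn n)) (f : Cn n → ℂ) : ℝ≥0∞ :=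
  (∫⁻ z in U, (‖f z‖₊ : ℝ≥0∞) ^ 2 * ENNReal.ofReal (Real.exp (-2 * Φ z / hb))) ^ (1 / 2 : ℝ)

def wInner {n : ℕ} (hb : ℝ) (Φ : Cn n → ℝ) (U : Set (Cn n)) (f g : Cn n → ℂ) : ℂ :=
  ∫ z in U, f z * starRingEnd ℂ (g z) * (Real.exp (-2 * Φ z / hb) : ℂ)

/-- membership in `L²_loc(Ω)` -/
def MemL2loc {n : ℕ} (Ω : Set (Cn n)) (u : Cn n → ℂ) : Prop :=
  AEStronglyMeasurable u (volume.restrict Ω) ∧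
    ∀ K : Set (Cn n), IsCompact K → K ⊆ Ω → (∫⁻ z in K, (‖u z‖₊ : ℝ≥0∞) ^ 2) < ⊤

/-- `Ω' ⋐ Ω`: open with compact closure contained in `Ω`. -/
def Cpt {n : ℕ} (Ω' Ω : Set (Cn n)) : Prop :=
  IsOpen Ω' ∧ IsCompact (closure Ω') ∧ closure Ω' ⊆ Ω

/-- test function in `C_c^∞(Ω)` -/
def IsTest {n : ℕ} (Ω : Set (Cn n)) (χ : Cn n → ℂ) : Prop :=
  ContDiff ℝ (⊤ : ℕ∞) χ ∧ HasCompactSupport χ ∧ tsupport χ ⊆ Ω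

/-- `A = O(1) : L²_{Φ₁,loc}(Ω) → L²_{Φ₂,loc}(Ω)` uniformly in `ħ ∈ (0, ħ₀]`. -/
def UnifCont {n : ℕ} (hb₀ : ℝ) (Ω : Set (Cn n)) (Φ₁ Φ₂ : Cn n → ℝ)
    (A : ℝ → (Cn n → ℂ) → Cn n → ℂ) : Prop :=
  ∀ Ω₂' : Set (Cn n), Cpt Ω₂' Ω → ∃ Ω₁' : Set (Cn n), Cpt Ω₁' Ω ∧ ∃ C : ℝ, 0 < C ∧
    ∀ hb ∈ Set.Ioc (0 : ℝ) hb₀, ∀ u : Cn n → ℂ, MemL2loc Ω u →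
      L2wNorm hb Φ₂ Ω₂' (A hb u) ≤ ENNReal.ofReal C * L2wNorm hb Φ₁ Ω₁' u

/-- uniformly properly supported family of operators -/
def UnifProp {n : ℕ} (hb₀ : ℝ) (Ω : Set (Cn n)) (A : ℝ → (Cn n → ℂ) → Cn n → ℂ) : Prop :=
  (∀ Ω₂' : Set (Cn n), Cpt Ω₂' Ω → ∃ Ω₁' : Set (Cn n), Cpt Ω₁' Ω ∧
    ∀ hb ∈ Set.Ioc (0 : ℝ) hb₀, ∀ u : Cn n → ℂ, MemL2loc Ω u →
      (∀ᵐ z ∂(volume : Measure (Cn n)), z ∈ Ω₁' → u z = 0) →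
      (∀ᵐ z ∂(volume : Measure (Cn n)), z ∈ Ω₂' → A hb u z = 0)) ∧
  (∀ Ω₁' : Set (Cn n), Cpt Ω₁' Ω → ∃ Ω₂' : Set (Cn n), Cpt Ω₂' Ω ∧
    ∀ hb ∈ Set.Ioc (0 : ℝ) hb₀, ∀ u : Cn n → ℂ, MemL2loc Ω u →
      Function.support u ⊆ Ω₁' → Function.support (A hb u) ⊆ Ω₂')

/-- negligible family of operators on `L²_{Φ,loc}(Ω)` -/
def Negl {n : ℕ} (hb₀ : ℝ) (Ω : Set (Cn n)) (Φ : Cn n → ℝ)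
    (A : ℝ → (Cn n → ℂ) → Cn n → ℂ) : Prop :=
  ∃ Φ₂ : Cn n → ℝ, ContinuousOn Φ₂ Ω ∧ (∀ z ∈ Ω, Φ₂ z < Φ z) ∧ UnifCont hb₀ Ω Φ Φ₂ A

/-- classical analytic symbol of order zero on `Ω` -/
def IsCAS {E : Type*} [NormedAddCommGroup E] [NormedSpace ℂ E] (Ω : Set E)
    (a : ℝ → E → ℂ) : Prop :=
  (∀ hb ∈ Set.Ioc (0 : ℝ) 1, DifferentiableOn ℂ (a hb) Ω) ∧
  (∀ K : Set E, K ⊆ Ω → IsCompact K → ∃ M : ℝ, ∀ hb ∈ Set.Ioc (0 : ℝ) 1, ∀ z ∈ K, ‖a hb z‖ ≤ M) ∧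
  ∃ c : ℕ → E → ℂ, (∀ j, DifferentiableOn ℂ (c j) Ω) ∧
    ∀ K : Set E, K ⊆ Ω → IsCompact K → ∃ C : ℝ, 0 < C ∧
      (∀ j : ℕ, ∀ z ∈ K, ‖c j z‖ ≤ C ^ (j + 1) * (j : ℝ) ^ j) ∧
      (∀ N : ℕ, ∀ hb ∈ Set.Ioc (0 : ℝ) 1, ∀ z ∈ K,
        ‖a hb z - ∑ j ∈ Finset.range N, c j z * (hb : ℂ) ^ j‖ ≤ hb ^ N * C ^ (N + 1) * (N : ℝ) ^ N)

/-- determinant of the matrix `∂_w∂_x ψ` of second holomorphic derivatives -/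
def psiDet {n : ℕ} (ψ : Cn n → Cn n → ℂ) (x w : Cn n) : ℂ :=
  (Matrix.of fun j k => wDz j (fun x' => wDz k (ψ x') w) x).det

/-- Brg quantization with radius `r`, restricted to the domain `U` -/
def OpBrg {n : ℕ} (hb r : ℝ) (Φ : Cn n → ℝ) (ψ : Cn n → Cn n → ℂ)
    (a : Cn n × Cn n → ℂ) (U : Set (Cn n)) (u : Cn n → ℂ) (x : Cn n) : ℂ :=
  ∫ y in Metric.ball x r ∩ U,
    (((2 : ℝ) ^ n / (Real.pi * hb) ^ n : ℝ) : ℂ) *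
      Complex.exp ((2 / hb : ℂ) * (ψ x (conjv y) - (Φ y : ℂ))) *
      a (x, conjv y) * psiDet ψ x (conjv y) * u y

/-- the contour momentum `θ(x,y)` of slope `R` -/
def thetaC {n : ℕ} (R : ℝ) (Φ : Cn n → ℝ) (x y : Cn n) : Cn n := fun j =>
  (2 / Complex.I) * wDz j (cplx Φ) x + Complex.I * (R : ℂ) * (starRingEnd ℂ (x j) - starRingEnd ℂ (y j))

/-- complex Weyl quantization along the contour of slope `R`, radius `r`, domain `U` -/
def OpW {n : ℕ} (hb r R : ℝ) (Φ : Cn n → ℝ) (b : Cn n × Cn n → ℂ)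
    (U : Set (Cn n)) (u : Cn n → ℂ) (x : Cn n) : ℂ :=
  ∫ y in {y : Cn n | ‖y - x‖ ≤ r} ∩ U,
    ((((2 * Real.pi * hb) ^ n : ℝ))⁻¹ : ℂ) * ((-2 : ℂ) * (R : ℂ)) ^ n *
      Complex.exp ((Complex.I / (hb : ℂ)) * dotC (x - y) (thetaC R Φ x y)) *
      b ((2 : ℂ)⁻¹ • (x + y), thetaC R Φ x y) * u y

/-- `Pu` is the value at `u` of the orthogonal projection onto entire functions in `L²_Φ(ℂⁿ)` -/
def ProjProp {n : ℕ} (hb : ℝ) (Φ : Cn n → ℝ) (u Pu : Cn n → ℂ) : Prop :=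
  Differentiable ℂ Pu ∧ L2wNorm hb Φ Set.univ Pu < ⊤ ∧
    ∀ v : Cn n → ℂ, Differentiable ℂ v → L2wNorm hb Φ Set.univ v < ⊤ →
      wInner hb Φ Set.univ (fun z => u z - Pu z) v = 0

/-- `v` is the distributional `∂̄` of `u` on `Ω` (componentwise) -/
def IsDbar {n : ℕ} (Ω : Set (Cn n)) (u : Cn n → ℂ) (v : Fin n → Cn n → ℂ) : Prop :=
  ∀ j : Fin n, ∀ χ : Cn n → ℂ, IsTest Ω χ →
    ∫ z, u z * wDzbar j χ z = -∫ z, v j z * χ z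

/-- The inclusion `ℝⁿ → ℂⁿ`. -/
def reC {n : ℕ} (x : Fin n → ℝ) : Cn n := fun j => (x j : ℂ)


section WeightedNorm

variable {n : ℕ} {hb : ℝ} {Φ Ψ : Cn n → ℝ} {U V : Set (Cn n)} {f : Cn n → ℂ}

lemma L2wNorm_mono_set (h : U ⊆ V) : L2wNorm hb Φ U f ≤ L2wNorm hb Φ V f :=
  ENNReal.rpow_le_rpow (lintegral_mono_set h) (by norm_num)

lemma L2wNorm_anti_weight (hb0 : 0 < hb) (hU : MeasurableSet U) (h : ∀ z ∈ U, Φ z ≤ Ψ z) :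
    L2wNorm hb Ψ U f ≤ L2wNorm hb Φ U f := by
  refine ENNReal.rpow_le_rpow (setLIntegral_mono' hU fun z hz => ?_) (by norm_num)
  have := h z hz
  gcongr _ * ENNReal.ofReal (Real.exp (?_ / _))
  linarith

lemma L2wNorm_union_le :
    L2wNorm hb Φ (U ∪ V) f ≤ L2wNorm hb Φ U f + L2wNorm hb Φ V f :=
  (ENNReal.rpow_le_rpow (lintegral_union_le _ U V) (by norm_num)).trans
    (ENNReal.rpow_add_le_add_rpow _ _ (by norm_num) (by norm_num))

lemma L2wNorm_sub_const (c : ℝ) :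
    L2wNorm hb (fun z => Φ z - c) U f =
      ENNReal.ofReal (Real.exp (2 * c / hb)) ^ (1 / 2 : ℝ) * L2wNorm hb Φ U f := by
  unfold L2wNorm
  rw [← ENNReal.mul_rpow_of_nonneg _ _ (by norm_num),
    ← lintegral_const_mul' _ _ ENNReal.ofReal_ne_top]
  congr 2 with z
  rw [mul_left_comm, ← ENNReal.ofReal_mul (Real.exp_pos _).le, ← Real.exp_add]
  ring_nf

end WeightedNorm

lemma Cpt.union {n : ℕ} {U V Ω : Set (Cn n)} (hU : Cpt U Ω) (hV : Cpt V Ω) : Cpt (U ∪ V) Ω := by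
  refine ⟨hU.1.union hV.1, ?_, ?_⟩ <;> rw [closure_union]
  exacts [hU.2.1.union hV.2.1, union_subset hU.2.2 hV.2.2]

/-- The estimate in `UnifCont` for a single target set `S`. -/
def BoundedTo {n : ℕ} (hb₀ : ℝ) (Ω : Set (Cn n)) (Φ₁ Φ₂ : Cn n → ℝ)
    (A : ℝ → (Cn n → ℂ) → Cn n → ℂ) (S : Set (Cn n)) : Prop :=
  ∃ Ω₁' : Set (Cn n), Cpt Ω₁' Ω ∧ ∃ C : ℝ, 0 < C ∧
    ∀ hb ∈ Set.Ioc (0 : ℝ) hb₀, ∀ u : Cn n → ℂ, MemL2loc Ω u →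
      L2wNorm hb Φ₂ S (A hb u) ≤ ENNReal.ofReal C * L2wNorm hb Φ₁ Ω₁' u

section BoundedTo

variable {n : ℕ} {hb₀ : ℝ} {Ω : Set (Cn n)} {Φ Φ₁ Φ₂ Ψ : Cn n → ℝ}
  {A : ℝ → (Cn n → ℂ) → Cn n → ℂ} {S T : Set (Cn n)}

lemma BoundedTo.empty : BoundedTo hb₀ Ω Φ₁ Φ₂ A ∅ :=
  ⟨∅, ⟨isOpen_empty, by simp, by simp⟩, 1, one_pos, fun hb _ u _ => by simp [L2wNorm]⟩

lemma BoundedTo.mono (h : BoundedTo hb₀ Ω Φ₁ Φ₂ A T) (hST : S ⊆ T) :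
    BoundedTo hb₀ Ω Φ₁ Φ₂ A S := by
  obtain ⟨U, hU, C, hC, H⟩ := h
  exact ⟨U, hU, C, hC, fun hb hhb u hu => (L2wNorm_mono_set hST).trans (H hb hhb u hu)⟩

lemma BoundedTo.union (hS : BoundedTo hb₀ Ω Φ₁ Φ₂ A S) (hT : BoundedTo hb₀ Ω Φ₁ Φ₂ A T) :
    BoundedTo hb₀ Ω Φ₁ Φ₂ A (S ∪ T) := by
  obtain ⟨U, hU, C, hC, H⟩ := hS
  obtain ⟨V, hV, D, hD, K⟩ := hT
  refine ⟨U ∪ V, hU.union hV, C + D, add_pos hC hD, fun hb hhb u hu => ?_⟩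
  rw [ENNReal.ofReal_add hC.le hD.le, add_mul]
  refine L2wNorm_union_le.trans (add_le_add ?_ ?_)
  · exact (H hb hhb u hu).trans (by gcongr; exact L2wNorm_mono_set subset_union_left)
  · exact (K hb hhb u hu).trans (by gcongr; exact L2wNorm_mono_set subset_union_right)

lemma BoundedTo.mono_weight (h : BoundedTo hb₀ Ω Φ₁ Φ₂ A S) (hS : MeasurableSet S)
    (hle : ∀ z ∈ S, Φ₂ z ≤ Ψ z) : BoundedTo hb₀ Ω Φ₁ Ψ A S := by
  obtain ⟨U, hU, C, hC, H⟩ := h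
  exact ⟨U, hU, C, hC, fun hb hhb u hu =>
    (L2wNorm_anti_weight hhb.1 hS hle).trans (H hb hhb u hu)⟩

/-- A strict gain in the source weight yields a constant gain in the target weight. -/
lemma BoundedTo.exists_sub_const (h : BoundedTo hb₀ Ω Φ Φ A S) (hΦ : ContinuousOn Φ Ω)
    (hΦ₁ : ContinuousOn Φ₁ Ω) (hlt : ∀ z ∈ Ω, Φ₁ z < Φ z) :
    ∃ δ > 0, BoundedTo hb₀ Ω Φ₁ (fun z => Φ z - δ) A S := by
  obtain ⟨U, hU, C, hC, H⟩ := h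
  obtain ⟨δ, hδ, hle⟩ := hU.2.1.exists_forall_le' ((hΦ.sub hΦ₁).mono hU.2.2) (a := 0)
    fun z hz => sub_pos.2 (hlt z (hU.2.2 hz))
  refine ⟨δ, hδ, U, hU, C, hC, fun hb hhb u hu => ?_⟩
  calc L2wNorm hb (fun z => Φ z - δ) S (A hb u)
      ≤ ENNReal.ofReal C * L2wNorm hb (fun z => Φ z - δ) U u := by
        rw [L2wNorm_sub_const, L2wNorm_sub_const, mul_left_comm]
        gcongr
        exact H hb hhb u hu
    _ ≤ ENNReal.ofReal C * L2wNorm hb Φ₁ U u := by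
        gcongr
        refine L2wNorm_anti_weight hhb.1 hU.1.measurableSet fun z hz => ?_
        have : δ ≤ Φ z - Φ₁ z := hle z (subset_closure hz)
        linarith

end BoundedTo

/-- if `A` is uniformly continuous on `L²_{Φ,loc}(Ω)` and `Φ₁ < Φ` is
continuous, then there is a continuous `Φ₂ < Φ` such that `A` is uniformly continuous
from `L²_{Φ₁,loc}(Ω)` to `L²_{Φ₂,loc}(Ω)`. -/
theorem statement7 {n : ℕ} (Ω : Set (Cn n)) (hΩ : IsOpen Ω)
    (Φ : Cn n → ℝ) (hΦ : ContinuousOn Φ Ω)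
    (hb₀ : ℝ) (hhb₀ : 0 < hb₀)
    (A : ℝ → (Cn n → ℂ) → Cn n → ℂ)
    (hlin : ∀ hb ∈ Set.Ioc (0 : ℝ) hb₀, IsLinearMap ℂ (A hb))
    (hA : UnifCont hb₀ Ω Φ Φ A)
    (Φ₁ : Cn n → ℝ) (hΦ₁ : ContinuousOn Φ₁ Ω) (hΦ₁lt : ∀ z ∈ Ω, Φ₁ z < Φ z) :
    ∃ Φ₂ : Cn n → ℝ, ContinuousOn Φ₂ Ω ∧ (∀ z ∈ Ω, Φ₂ z < Φ z) ∧
      UnifCont hb₀ Ω Φ₁ Φ₂ A := by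
  let P : Cn n → ℝ → Prop := fun y c =>
    ∃ V : Set (Cn n), IsOpen V ∧ y ∈ V ∧ BoundedTo hb₀ Ω Φ₁ (fun z => Φ z - c) A V
  let t : Ω → Set ℝ := fun y => {c | 0 < c ∧ ∃ d > c, P y d}
  have ht : ∀ y, Convex ℝ (t y) := fun y => by
    refine Set.OrdConnected.convex ⟨?_⟩
    rintro a ⟨ha, -⟩ b ⟨-, d, hd, hP⟩ c ⟨hac, hcb⟩
    exact ⟨ha.trans_le hac, d, hcb.trans_lt hd, hP⟩
  have hloc : ∀ x : Ω, ∃ c : ℝ, ∀ᶠ y in 𝓝 x, c ∈ t y := fun x => by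
    obtain ⟨V, hV, hxV, hVΩ, hVc⟩ := exists_open_between_and_isCompact_closure
      (isCompact_singleton (x := (x : Cn n))) hΩ (singleton_subset_iff.2 x.2)
    obtain ⟨δ, hδ, hb⟩ :=
      BoundedTo.exists_sub_const (hA V ⟨hV, hVc, hVΩ⟩) hΦ hΦ₁ hΦ₁lt
    refine ⟨δ / 2, ?_⟩
    filter_upwards [continuous_subtype_val.continuousAt.preimage_mem_nhds
      (hV.mem_nhds (singleton_subset_iff.1 hxV))] with y hy
    exact ⟨half_pos hδ, δ, half_lt_self hδ, V, hV, hy, hb⟩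
  obtain ⟨g, hg⟩ := exists_continuous_forall_mem_convex_of_local_const ht hloc
  obtain ⟨η, hη, hηg⟩ : ∃ η : Cn n → ℝ, ContinuousOn η Ω ∧ ∀ z : Ω, η z = g z := by
    have hext : ∀ z : Ω, Function.extend Subtype.val g 0 (z : Cn n) = g z :=
      Subtype.val_injective.extend_apply g 0
    refine ⟨_, continuousOn_iff_continuous_domRestrict.2 ?_, hext⟩
    convert g.continuous using 1
    exact funext hext
  have hηt : ∀ z (hz : z ∈ Ω), η z ∈ t ⟨z, hz⟩ := fun z hz => by
    rw [hηg ⟨z, hz⟩]; exact hg _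
  refine ⟨fun z => Φ z - η z, hΦ.sub hη, fun z hz => sub_lt_self _ (hηt z hz).1,
    fun S hS => ?_⟩
  refine BoundedTo.mono (T := closure S) ?_ subset_closure
  refine hS.2.1.induction_on (p := BoundedTo hb₀ Ω Φ₁ (fun z => Φ z - η z) A)
    .empty (fun _ _ h h' => h'.mono h) (fun _ _ h h' => h.union h') fun x hx => ?_
  have hxΩ := hS.2.2 hx
  obtain ⟨-, d, hd, V, hV, hxV, hb⟩ := hηt x hxΩ
  obtain ⟨W, hWsub, hW, hxW⟩ := _root_.mem_nhds_iff.1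
    (((hη.continuousAt (hΩ.mem_nhds hxΩ)).eventually_lt_const hd).and (hV.mem_nhds hxV))
  refine ⟨W, mem_nhdsWithin_of_mem_nhds (hW.mem_nhds hxW), ?_⟩
  exact (hb.mono fun z hz => (hWsub hz).2).mono_weight hW.measurableSet fun z hz =>
    sub_le_sub_left (hWsub hz).1.le _
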